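/- Let G be a finitely generated residually finite group and K a normal subgroup of G of finite index. Let Inv denote the set of finite-index subgroups N of K that are normal in G (equivalently, N ∈ ν(K) with gNg^{-1} = N for all g ∈ G; this coincides with {N ∩ K : N ∈ ν(G)} and with the set Inv(φ) of subgroups invariant under the induced outer action φ : G/K → Out(K)). Then RF_{G,ν(G),B_G} ≈ RF_{K,Inv,B_K}. -/

import Mathlib

/-- The word ball of radius `r` in a group `G` with respect to a finite (generating)
set `S`: products of at most `r` elements of `S ∪ S⁻¹`. -/
def wordBall {G : Type*} [Group G] (S : Finset G) (r : ℝ) : Set G :=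
  {g | ∃ l : List G, (∀ x ∈ l, x ∈ S ∨ x⁻¹ ∈ S) ∧ (l.length : ℝ) ≤ r ∧ l.prod = g}

/-- `ν(G)`: the set of finite-index normal subgroups of `G`. -/
def nu (G : Type*) [Group G] : Set (Subgroup G) :=
  {N | N.Normal ∧ N.FiniteIndex}

/-- The divisibility function `D_{G,P}(g) = min {[G:N] : N ∈ P, g ∉ N}`, with value `∞`
when no such `N` exists (in particular at `g = 1`). -/
noncomputable def divFn {G : Type*} [Group G] (P : Set (Subgroup G)) (g : G) : ℕ∞ :=
  sInf {n : ℕ∞ | ∃ N ∈ P, g ∉ N ∧ n = (N.index : ℕ∞)}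

/-- The residual finiteness growth function
`RF_{G,P,B_G}(r) = max {D_{G,P}(g) : 1 ≠ g ∈ B_G(r)}` (as a real-valued function,
taking the value `1` on an empty set of elements). -/
noncomputable def RFgrowth {G : Type*} [Group G] (P : Set (Subgroup G)) (S : Finset G)
    (r : ℝ) : ℝ :=
  sSup (insert 1 ((fun g => ((divFn P g).toNat : ℝ)) '' (wordBall S r \ {1})))

/-- `f ⪯ g`: there is `C > 0` with `f(r) ≤ C·g(C·r)` for all `r ≥ max {1, 1/C}`. -/
def GrowthLE (f g : ℝ → ℝ) : Prop :=
  ∃ C : ℝ, 0 < C ∧ ∀ r : ℝ, max 1 (1 / C) ≤ r → f r ≤ C * g (C * r)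

/-- `f ≈ g`: `f ⪯ g` and `g ⪯ f`. -/
def GrowthEquiv (f g : ℝ → ℝ) : Prop :=
  GrowthLE f g ∧ GrowthLE g f

section WordBall

variable {G : Type*} [Group G]

theorem wordBall_mono (S : Finset G) {r s : ℝ} (h : r ≤ s) : wordBall S r ⊆ wordBall S s :=
  fun _ ⟨l, hl, hr, hg⟩ => ⟨l, hl, hr.trans h, hg⟩

theorem one_mem_wordBall (S : Finset G) {r : ℝ} (hr : 0 ≤ r) : (1 : G) ∈ wordBall S r :=
  ⟨[], by simp, by simpa using hr, rfl⟩

theorem mul_mem_wordBall {S : Finset G} {r s : ℝ} {g h : G} (hg : g ∈ wordBall S r)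
    (hh : h ∈ wordBall S s) : g * h ∈ wordBall S (r + s) := by
  obtain ⟨l, hl, hr, rfl⟩ := hg
  obtain ⟨k, hk, hs, rfl⟩ := hh
  refine ⟨l ++ k, fun x hx => ?_, ?_, List.prod_append⟩
  · exact (List.mem_append.1 hx).elim (hl x) (hk x)
  · rw [List.length_append]
    push_cast
    exact add_le_add hr hs

theorem finite_letters (S : Finset G) : {x : G | x ∈ S ∨ x⁻¹ ∈ S}.Finite :=
  S.finite_toSet.union (S.finite_toSet.preimage inv_injective.injOn)

theorem finite_wordBall (S : Finset G) (r : ℝ) : (wordBall S r).Finite := by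
  have : Finite {x : G // x ∈ S ∨ x⁻¹ ∈ S} := finite_letters S
  refine ((List.finite_length_le {x : G // x ∈ S ∨ x⁻¹ ∈ S} ⌊r⌋₊).image
    fun l => (l.map Subtype.val).prod).subset ?_
  rintro _ ⟨l, hl, hr, rfl⟩
  lift l to List {x : G // x ∈ S ∨ x⁻¹ ∈ S} using hl
  exact ⟨l, Nat.le_floor (by simpa using hr), rfl⟩

theorem exists_mem_wordBall {S : Finset G} (hS : Subgroup.closure (S : Set G) = ⊤) (g : G) :
    ∃ n : ℕ, g ∈ wordBall S n := by
  have hg : g ∈ Subgroup.closure (S : Set G) := hS ▸ Subgroup.mem_top g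
  rw [← Subgroup.mem_toSubmonoid, Subgroup.closure_toSubmonoid] at hg
  obtain ⟨l, hl, rfl⟩ := Submonoid.exists_list_of_mem_closure hg
  exact ⟨l.length, l, hl, le_rfl, rfl⟩

/-- A finite set of elements of a finitely generated group lies in some word ball. -/
theorem exists_subset_wordBall {S : Finset G} (hS : Subgroup.closure (S : Set G) = ⊤)
    {A : Set G} (hA : A.Finite) : ∃ n : ℕ, 1 ≤ n ∧ A ⊆ wordBall S n := by
  choose f hf using exists_mem_wordBall hS
  obtain ⟨n, hn⟩ := (hA.image f).bddAbove
  refine ⟨n + 1, by omega, fun a ha => wordBall_mono S ?_ (hf a)⟩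
  exact_mod_cast (hn ⟨a, ha, rfl⟩).trans n.le_succ

/-- Homomorphisms between finitely generated groups are Lipschitz for word lengths. -/
theorem exists_map_mem_wordBall {H : Type*} [Group H] {S : Finset G} {T : Finset H}
    (hS : Subgroup.closure (S : Set G) = ⊤) (φ : H →* G) :
    ∃ C : ℕ, 1 ≤ C ∧ ∀ r : ℝ, ∀ h ∈ wordBall T r, φ h ∈ wordBall S (C * r) := by
  obtain ⟨C, hC, hball⟩ := exists_subset_wordBall hS ((finite_letters T).image φ)
  refine ⟨C, hC, ?_⟩
  rintro r _ ⟨l, hl, hr, rfl⟩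
  refine wordBall_mono S (mul_le_mul_of_nonneg_left hr C.cast_nonneg) ?_
  clear hr
  induction l with
  | nil => simpa using one_mem_wordBall S le_rfl
  | cons x l ih =>
    have h := mul_mem_wordBall (hball ⟨x, hl x (by simp), rfl⟩)
      (ih fun y hy => hl y (List.mem_cons_of_mem _ hy))
    rw [List.prod_cons, map_mul]
    convert h using 1
    rw [List.length_cons]
    push_cast
    ring_nf

/-- A finite-index normal subgroup is undistorted, by Schreier's rewriting process. -/
theorem exists_mem_wordBall_subgroup (S : Finset G) (K : Subgroup G) [K.Normal] [K.FiniteIndex]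
    {T : Finset K} (hT : Subgroup.closure (T : Set K) = ⊤) :
    ∃ C : ℕ, 1 ≤ C ∧ ∀ r : ℝ, ∀ k : K, (k : G) ∈ wordBall S r → k ∈ wordBall T (C * r) := by
  obtain ⟨σ, hσ, hσ1⟩ : ∃ σ : G ⧸ K → G, (∀ q, (σ q : G ⧸ K) = q) ∧ σ 1 = 1 :=
    ⟨fun q => q.out * (1 : G ⧸ K).out⁻¹, fun q => by simp, by simp⟩
  have hmem : ∀ (q : G ⧸ K) (g : G), σ q * g * (σ (q * g))⁻¹ ∈ K := fun q g => by
    rw [← QuotientGroup.eq_one_iff]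
    simp [hσ]
  let c : G ⧸ K → G → K := fun q g => ⟨_, hmem q g⟩
  have hcmul : ∀ q g h, c q (g * h) = c q g * c (q * g) h := fun q g h => by
    apply Subtype.ext
    simp only [c, Subgroup.coe_mul, QuotientGroup.mk_mul, mul_assoc, inv_mul_cancel_left]
  obtain ⟨C, hC, hball⟩ := exists_subset_wordBall hT
    ((Set.finite_univ (α := G ⧸ K)).image2 c (finite_letters S))
  refine ⟨C, hC, ?_⟩
  rintro r k ⟨l, hl, hr, hk⟩
  refine wordBall_mono T (mul_le_mul_of_nonneg_left hr C.cast_nonneg) ?_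
  have key : ∀ q : G ⧸ K, c q l.prod ∈ wordBall T (C * l.length) := by
    clear hr hk
    induction l with
    | nil =>
      intro q
      have : c q 1 = 1 := Subtype.ext (by simp [c])
      simpa [this] using one_mem_wordBall T le_rfl
    | cons x l ih =>
      intro q
      have h := mul_mem_wordBall (hball ⟨q, Set.mem_univ q, x, hl x (by simp), rfl⟩)
        (ih (fun y hy => hl y (List.mem_cons_of_mem _ hy)) (q * x))
      rw [List.prod_cons, hcmul]
      convert h using 1
      rw [List.length_cons]
      push_cast
      ring_nf
  convert key 1
  apply Subtype.ext
  have : (((k : G)) : G ⧸ K) = 1 := (QuotientGroup.eq_one_iff _).2 k.2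
  simp [c, hk, this, hσ1]

end WordBall

section DivFn

variable {G : Type*} [Group G]

theorem divFn_toNat_le {P : Set (Subgroup G)} {g : G} {N : Subgroup G} (hN : N ∈ P)
    (hg : g ∉ N) : (divFn P g).toNat ≤ N.index :=
  ENat.toNat_le_of_le_natCast (sInf_le ⟨N, hN, hg, rfl⟩)

theorem exists_divFn_toNat_eq {P : Set (Subgroup G)} {g : G} (h : ∃ N ∈ P, g ∉ N) :
    ∃ N ∈ P, g ∉ N ∧ (divFn P g).toNat = N.index := by
  obtain ⟨N, hN, hg⟩ := h
  obtain ⟨M, hM, hgM, hM'⟩ :=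
    csInf_mem (s := {n : ℕ∞ | ∃ N ∈ P, g ∉ N ∧ n = (N.index : ℕ∞)}) ⟨_, N, hN, hg, rfl⟩
  exact ⟨M, hM, hgM, by rw [divFn, hM', ENat.toNat_natCast]⟩

theorem exists_mem_nu_notMem (hres : sInf (nu G) = ⊥) {g : G} (hg : g ≠ 1) :
    ∃ N ∈ nu G, g ∉ N := by
  by_contra! h
  exact hg (Subgroup.mem_bot.1 (hres ▸ Subgroup.mem_sInf.2 h))

theorem bddAbove_RFgrowth (P : Set (Subgroup G)) (S : Finset G) (r : ℝ) :
    BddAbove (insert 1 ((fun g => ((divFn P g).toNat : ℝ)) '' (wordBall S r \ {1}))) :=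
  ((((finite_wordBall S r).sdiff).image _).insert 1).bddAbove

theorem one_le_RFgrowth (P : Set (Subgroup G)) (S : Finset G) (r : ℝ) : 1 ≤ RFgrowth P S r :=
  le_csSup (bddAbove_RFgrowth P S r) (Set.mem_insert _ _)

theorem divFn_toNat_le_RFgrowth (P : Set (Subgroup G)) {S : Finset G} {r : ℝ} {g : G}
    (hg : g ∈ wordBall S r) (hg1 : g ≠ 1) : ((divFn P g).toNat : ℝ) ≤ RFgrowth P S r :=
  le_csSup (bddAbove_RFgrowth P S r) (Set.mem_insert_of_mem _ ⟨g, ⟨hg, hg1⟩, rfl⟩)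

/-- Elementwise criterion for comparing residual finiteness growth functions. -/
theorem growthLE_RFgrowth {H : Type*} [Group H] {P : Set (Subgroup G)} {Q : Set (Subgroup H)}
    {S : Finset G} {T : Finset H} {A C : ℕ} (hC : 1 ≤ C)
    (h : ∀ r : ℝ, ∀ g ∈ wordBall S r, g ≠ 1 → (divFn P g).toNat ≤ A ∨
      ∃ k ∈ wordBall T (C * r), k ≠ 1 ∧ (divFn P g).toNat ≤ A * (divFn Q k).toNat) :
    GrowthLE (RFgrowth P S) (RFgrowth Q T) := by
  obtain ⟨B, hCB, hAB⟩ : ∃ B : ℕ, C ≤ B ∧ A ≤ B := ⟨max C A, le_max_left .., le_max_right ..⟩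
  have hB : (1 : ℝ) ≤ B := by exact_mod_cast hC.trans hCB
  have hAB' : (A : ℝ) ≤ B := by exact_mod_cast hAB
  refine ⟨B, by linarith, fun r hr => ?_⟩
  have hr1 : 1 ≤ r := (le_max_left _ _).trans hr
  have hRF := one_le_RFgrowth Q T (B * r)
  refine csSup_le (Set.insert_nonempty _ _) ?_
  rintro _ (rfl | ⟨g, ⟨hg, hg1⟩, rfl⟩)
  · exact one_le_mul_of_one_le_of_one_le hB hRF
  · rcases h r g hg hg1 with hA | ⟨k, hk, hk1, hA⟩
    · calc ((divFn P g).toNat : ℝ) ≤ A := by exact_mod_cast hA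
        _ ≤ B := hAB'
        _ ≤ B * RFgrowth Q T (B * r) := le_mul_of_one_le_right (by linarith) hRF
    · have hk' : k ∈ wordBall T (B * r) := wordBall_mono T (by gcongr) hk
      calc ((divFn P g).toNat : ℝ) ≤ A * (divFn Q k).toNat := by exact_mod_cast hA
        _ ≤ B * RFgrowth Q T (B * r) :=
          mul_le_mul hAB' (divFn_toNat_le_RFgrowth Q hk' hk1) (by positivity) (by positivity)

theorem subgroupOf_mem_of_mem_nu {N K : Subgroup G} (hK : K.Normal) (hN : N ∈ nu G) :
    N.subgroupOf K ∈ {N : Subgroup K | N.FiniteIndex ∧ (N.map K.subtype).Normal} := by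
  obtain ⟨hNn, hNfi⟩ := hN
  refine ⟨inferInstance, ?_⟩
  rw [Subgroup.subgroupOf_map_subtype]
  infer_instance

end DivFn

/-- for a normal finite-index subgroup `K` of a finitely generated
residually finite group `G`, the residual finiteness growth of `G` (w.r.t. all
finite-index normal subgroups) agrees with the residual finiteness growth of `K`
with respect to the family of finite-index subgroups of `K` that are normal in `G`
(the subgroups invariant under the induced outer action of `G/K` on `K`). -/
theorem stmt_7 {G : Type*} [Group G] (S : Finset G)
    (hS : Subgroup.closure (S : Set G) = ⊤)
    (hres : sInf (nu G) = ⊥)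
    (K : Subgroup G) (hKn : K.Normal) (hKfi : K.FiniteIndex)
    (T : Finset K) (hT : Subgroup.closure (T : Set K) = ⊤) :
    GrowthEquiv (RFgrowth (nu G) S)
      (RFgrowth {N : Subgroup K | N.FiniteIndex ∧ (N.map K.subtype).Normal} T) := by
  constructor
  · obtain ⟨C, hC, hball⟩ := exists_mem_wordBall_subgroup S K hT
    refine growthLE_RFgrowth (A := K.index) hC fun r g hg hg1 => ?_
    by_cases hgK : g ∈ K
    · right
      lift g to K using hgK
      have hg1' : g ≠ 1 := fun h => hg1 (by simp [h])
      refine ⟨g, hball r g hg, hg1', ?_⟩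
      obtain ⟨N, hN, hgN⟩ := exists_mem_nu_notMem hres hg1
      obtain ⟨M, hM, hgM, hdiv⟩ := exists_divFn_toNat_eq
        ⟨N.subgroupOf K, subgroupOf_mem_of_mem_nu hKn hN, mt Subgroup.mem_subgroupOf.1 hgN⟩
      have hindex : (M.map K.subtype).index = K.index * M.index := by
        rw [Subgroup.index_map_subtype, mul_comm]
      have hMnu : M.map K.subtype ∈ nu G :=
        ⟨hM.2, ⟨hindex ▸ mul_ne_zero hKfi.index_ne_zero hM.1.index_ne_zero⟩⟩
      rw [hdiv, ← hindex]
      exact divFn_toNat_le hMnu (by simpa using hgM)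
    · exact Or.inl (divFn_toNat_le ⟨hKn, hKfi⟩ hgK)
  · obtain ⟨C, hC, hball⟩ := exists_map_mem_wordBall (T := T) hS K.subtype
    refine growthLE_RFgrowth (A := 1) hC fun r k hk hk1 => Or.inr ?_
    have hk1' : (k : G) ≠ 1 := fun h => hk1 (Subtype.ext h)
    refine ⟨k, hball r k hk, hk1', ?_⟩
    obtain ⟨N, hN, hkN, hdiv⟩ := exists_divFn_toNat_eq (exists_mem_nu_notMem hres hk1')
    rw [hdiv, one_mul]
    refine (divFn_toNat_le (subgroupOf_mem_of_mem_nu hKn hN)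
      (mt Subgroup.mem_subgroupOf.1 hkN)).trans ?_
    have := hN.1
    exact Nat.le_of_dvd (Nat.pos_of_ne_zero hN.2.index_ne_zero)
      (Subgroup.relIndex_dvd_index_of_normal N K)
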